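/- arXiv:math/9906194 — 5 statements merged into one kernel-verified Lean document; each statement's English description precedes it below -/
import Mathlib

section
/- If K²(1 − (1−p)²) < 1, then almost surely every connected component of the random graph G is finite. -/
open MeasureTheory

/-- Adjacency of the random graph: distinct `x, y` are joined iff `y - x ∈ N*` and at
least one of `B_x, B_y` equals 1 (here `ω x = true` means `B_x = 1`). -/
def Adj {d : ℕ} (Nstar : Finset (Fin d → ℤ)) (ω : (Fin d → ℤ) → Bool)
    (x y : Fin d → ℤ) : Prop :=
  x ≠ y ∧ y - x ∈ Nstar ∧ (ω x = true ∨ ω y = true)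

/-- Probability bound for disjoint pairs of sites. -/
lemma prob_pairs {V : Type*} [DecidableEq V] (p : ℝ) (hp : p ∈ Set.Ico (0:ℝ) 1)
    (P : Measure (V → Bool))
    (hiid : ∀ (S : Finset V) (b : V → Bool),
      P {ω | ∀ x ∈ S, ω x = b x} =
        ∏ x ∈ S, ENNReal.ofReal (if b x then p else 1 - p)) (u : ℕ → V) (m : ℕ) :
    ∀ (_ : Set.InjOn u (Set.Iio (2 * m))) (S : Finset V) (b : V → Bool)
      (_ : ∀ i < 2 * m, u i ∉ S),
      P {ω | (∀ x ∈ S, ω x = b x) ∧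
        ∀ i < m, (ω (u (2 * i)) = true ∨ ω (u (2 * i + 1)) = true)} ≤
        (∏ x ∈ S, ENNReal.ofReal (if b x then p else 1 - p)) *
          ENNReal.ofReal (1 - (1 - p) ^ 2) ^ m := by
  induction m with
  | zero =>
    intro _ S b _
    simp [hiid S b]
  | succ m ih =>
    intro hu S b hS
    have hu' : Set.InjOn u (Set.Iio (2 * m)) := hu.mono (fun i hi => by
      simp only [Set.mem_Iio] at *; omega)
    have hne : ∀ i < 2 * m + 2, ∀ j < 2 * m + 2, i ≠ j → u i ≠ u j := by
      intro i hi j hj hij h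
      exact hij (hu (by simp only [Set.mem_Iio]; omega) (by simp only [Set.mem_Iio]; omega) h)
    set a := u (2 * m) with ha
    set c := u (2 * m + 1) with hc
    have haS : a ∉ S := hS _ (by omega)
    have hcS : c ∉ S := hS _ (by omega)
    have hca : c ≠ a := hne _ (by omega) _ (by omega) (by omega)
    have h1 := ih hu' (insert a S) (Function.update b a true) (by
      intro i hi h
      rcases Finset.mem_insert.1 h with h | h
      · exact hne i (by omega) (2 * m) (by omega) (by omega) h
      · exact hS i (by omega) h)
    have h2 := ih hu' (insert c (insert a S))
      (Function.update (Function.update b a false) c true) (by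
      intro i hi h
      rcases Finset.mem_insert.1 h with h | h
      · exact hne i (by omega) (2 * m + 1) (by omega) (by omega) h
      rcases Finset.mem_insert.1 h with h | h
      · exact hne i (by omega) (2 * m) (by omega) (by omega) h
      · exact hS i (by omega) h)
    have hP1 : (∏ x ∈ S, ENNReal.ofReal (if Function.update b a true x then p else 1 - p)) =
        ∏ x ∈ S, ENNReal.ofReal (if b x then p else 1 - p) := by
      refine Finset.prod_congr rfl fun x hx => ?_
      rw [Function.update_of_ne (ne_of_mem_of_not_mem hx haS)]
    have hP2 : (∏ x ∈ S, ENNReal.ofReal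
        (if Function.update (Function.update b a false) c true x then p else 1 - p)) =
        ∏ x ∈ S, ENNReal.ofReal (if b x then p else 1 - p) := by
      refine Finset.prod_congr rfl fun x hx => ?_
      rw [Function.update_of_ne (ne_of_mem_of_not_mem hx hcS),
        Function.update_of_ne (ne_of_mem_of_not_mem hx haS)]
    rw [Finset.prod_insert haS, hP1] at h1
    rw [Finset.prod_insert (by simp [hca, hcS]), Finset.prod_insert haS, hP2] at h2
    simp only [Function.update_self, Function.update_of_ne hca.symm] at h1 h2
    have hq : ENNReal.ofReal (1 - (1 - p) ^ 2) =
        ENNReal.ofReal p + ENNReal.ofReal p * ENNReal.ofReal (1 - p) := by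
      rw [← ENNReal.ofReal_mul hp.1, ← ENNReal.ofReal_add hp.1
        (mul_nonneg hp.1 (by linarith [hp.2]))]
      congr 1; ring
    refine (measure_mono ?_).trans ((measure_union_le _ _).trans ((add_le_add h1 h2).trans ?_))
    · rintro ω ⟨hω, hω2⟩
      have hrest : ∀ i < m, (ω (u (2 * i)) = true ∨ ω (u (2 * i + 1)) = true) :=
        fun i hi => hω2 i (by omega)
      by_cases hωa : ω a = true
      · left
        refine ⟨fun x hx => ?_, hrest⟩
        rcases Finset.mem_insert.1 hx with rfl | h
        · simp [hωa]
        · rw [Function.update_of_ne (ne_of_mem_of_not_mem h haS)]; exact hω x h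
      · right
        have hωc : ω c = true := (hω2 m (by omega)).resolve_left hωa
        refine ⟨fun x hx => ?_, hrest⟩
        by_cases hxc : x = c
        · subst hxc; simp [hωc]
        rw [Function.update_of_ne hxc]
        by_cases hxa : x = a
        · subst hxa; simpa using hωa
        rw [Function.update_of_ne hxa]
        simp only [Finset.mem_insert, hxc, hxa, false_or] at hx
        exact hω x hx
    · apply le_of_eq
      simp only [if_true, Bool.false_eq_true, if_false]
      rw [hq]
      ring

/-- The graph as a `SimpleGraph`. -/
def gr {d : ℕ} (Nstar : Finset (Fin d → ℤ)) (hsym : ∀ z ∈ Nstar, -z ∈ Nstar)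
    (ω : (Fin d → ℤ) → Bool) : SimpleGraph (Fin d → ℤ) where
  Adj := Adj Nstar ω
  symm := ⟨by
    rintro x y ⟨h1, h2, h3⟩
    exact ⟨h1.symm, by simpa using hsym _ h2, h3.symm⟩⟩
  loopless := ⟨fun x h => h.1 rfl⟩

lemma ball_finite {d : ℕ} (Nstar : Finset (Fin d → ℤ)) (hsym : ∀ z ∈ Nstar, -z ∈ Nstar)
    (ω : (Fin d → ℤ) → Bool) (n : ℕ) : ∀ x,
    {y | ∃ w : (gr Nstar hsym ω).Walk x y, w.length = n}.Finite := by
  induction n with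
  | zero =>
    intro x
    refine (Set.finite_singleton x).subset ?_
    rintro y ⟨w, hw⟩
    exact (SimpleGraph.Walk.eq_of_length_eq_zero hw).symm
  | succ n ih =>
    intro x
    refine (Set.Finite.biUnion Nstar.finite_toSet (fun z _ => ih (x + z))).subset ?_
    rintro y ⟨w, hw⟩
    cases w with
    | nil => simp at hw
    | @cons _ v _ h w' =>
      have h' : Adj Nstar ω x v := h
      simp only [Set.mem_iUnion]
      refine ⟨v - x, h'.2.1, ?_⟩
      rw [add_sub_cancel]
      exact ⟨w', by simpa using hw⟩

lemma long_path {d : ℕ} (Nstar : Finset (Fin d → ℤ)) (hsym : ∀ z ∈ Nstar, -z ∈ Nstar)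
    (ω : (Fin d → ℤ) → Bool) (x : Fin d → ℤ)
    (h : ¬ {y : Fin d → ℤ | Relation.ReflTransGen (Adj Nstar ω) x y}.Finite) (n : ℕ) :
    ∃ s : Fin n → Nstar, ∃ u : ℕ → (Fin d → ℤ),
      u = (fun i => x + ∑ j ∈ Finset.range i,
        (if hj : j < n then (s ⟨j, hj⟩ : Fin d → ℤ) else 0)) ∧
      Set.InjOn u (Set.Iio n) ∧ ∀ i, i + 1 < n → (ω (u i) = true ∨ ω (u (i + 1)) = true) := by
  have hfin : {y | ∃ w : (gr Nstar hsym ω).Walk x y, w.length ≤ n}.Finite := by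
    refine (Set.Finite.biUnion (Finset.range (n+1)).finite_toSet
      (fun k _ => ball_finite Nstar hsym ω k x)).subset ?_
    rintro y ⟨w, hw⟩
    simp only [Set.mem_iUnion]
    exact ⟨w.length, by simpa using Nat.lt_succ_of_le hw, w, rfl⟩
  obtain ⟨y, hy, hy2⟩ : ∃ y, Relation.ReflTransGen (Adj Nstar ω) x y ∧
      ¬ ∃ w : (gr Nstar hsym ω).Walk x y, w.length ≤ n := by
    by_contra! hc
    exact h (hfin.subset hc)
  have hr : (gr Nstar hsym ω).Reachable x y :=
    ((gr Nstar hsym ω).reachable_iff_reflTransGen x y).2 hy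
  obtain ⟨w, hw⟩ := hr.exists_isPath
  push Not at hy2
  have hlen := hy2 w
  have hadj : ∀ i < n, Adj Nstar ω (w.getVert i) (w.getVert (i + 1)) :=
    fun i hi => w.adj_getVert_succ (by omega)
  have key : ∀ i ≤ n, x + ∑ j ∈ Finset.range i, (if hj : j < n then
      (w.getVert (j + 1) - w.getVert j) else 0) = w.getVert i := by
    intro i
    induction i with
    | zero => simp
    | succ i ih =>
      intro hi
      rw [Finset.sum_range_succ, ← add_assoc, ih (by omega), dif_pos (by omega)]
      abel
  refine ⟨fun j => ⟨w.getVert (j + 1) - w.getVert j, (hadj j j.2).2.1⟩, _, rfl, ?_, ?_⟩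
  · intro i hi j hj hij
    simp only [Set.mem_Iio] at hi hj
    simp only [key i hi.le, key j hj.le] at hij
    exact hw.getVert_injOn (by simp only [Set.mem_ofPred_eq]; omega)
      (by simp only [Set.mem_ofPred_eq]; omega) hij
  · intro i hi
    simp only [key i (by omega), key (i + 1) (by omega)]
    exact (hadj i (by omega)).2.2

/-- If `K²(1 − (1−p)²) < 1`, then almost surely every connected component of the
random graph `G` is finite. -/
theorem stmt2
    (d : ℕ) (hd : 1 ≤ d)
    (N : Finset (Fin d → ℤ)) (hN : N.Nonempty)
    (Nstar : Finset (Fin d → ℤ)) (hNstar : Nstar = N ∪ N.image (fun z => -z))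
    (p : ℝ) (hp : p ∈ Set.Ico (0:ℝ) 1)
    (P : Measure ((Fin d → ℤ) → Bool)) [IsProbabilityMeasure P]
    (hiid : ∀ (S : Finset (Fin d → ℤ)) (b : (Fin d → ℤ) → Bool),
      P {ω | ∀ x ∈ S, ω x = b x} =
        ∏ x ∈ S, ENNReal.ofReal (if b x then p else 1 - p))
    (hK : (Nstar.card : ℝ) ^ 2 * (1 - (1 - p) ^ 2) < 1) :
    P {ω | ∀ x : Fin d → ℤ,
        {y : Fin d → ℤ | Relation.ReflTransGen (Adj Nstar ω) x y}.Finite} = 1 := by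
  classical
  have hsym : ∀ z ∈ Nstar, -z ∈ Nstar := by
    subst hNstar
    intro z hz
    simp only [Finset.mem_union, Finset.mem_image] at hz ⊢
    rcases hz with hz | ⟨w, hw, rfl⟩
    · exact Or.inr ⟨z, hz, rfl⟩
    · left; simpa using hw
  have hae : ∀ᵐ ω ∂P, ∀ x : Fin d → ℤ,
      {y : Fin d → ℤ | Relation.ReflTransGen (Adj Nstar ω) x y}.Finite := by
    rw [ae_all_iff]
    intro x
    rw [ae_iff]
    set r : ENNReal := (Nstar.card : ENNReal) ^ 2 * ENNReal.ofReal (1 - (1 - p) ^ 2) with hr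
    have hr1 : r < 1 := by
      have : r = ENNReal.ofReal ((Nstar.card : ℝ) ^ 2 * (1 - (1 - p) ^ 2)) := by
        rw [ENNReal.ofReal_mul (by positivity), ENNReal.ofReal_pow (by positivity),
          ENNReal.ofReal_natCast]
      rw [this]
      exact ENNReal.ofReal_lt_one.2 hK
    have hb : ∀ m : ℕ, P {ω | ¬ {y : Fin d → ℤ |
        Relation.ReflTransGen (Adj Nstar ω) x y}.Finite} ≤ r ^ m := by
      intro m
      let U : (Fin (2 * m) → Nstar) → ℕ → (Fin d → ℤ) := fun s i =>
        x + ∑ j ∈ Finset.range i,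
          (if hj : j < 2 * m then (s ⟨j, hj⟩ : Fin d → ℤ) else 0)
      let E : (Fin (2 * m) → Nstar) → Set ((Fin d → ℤ) → Bool) := fun s =>
        {ω | Set.InjOn (U s) (Set.Iio (2 * m)) ∧
          ∀ i < m, (ω (U s (2 * i)) = true ∨ ω (U s (2 * i + 1)) = true)}
      have hE : ∀ s, P (E s) ≤ ENNReal.ofReal (1 - (1 - p) ^ 2) ^ m := by
        intro s
        by_cases hs : Set.InjOn (U s) (Set.Iio (2 * m))
        · have := prob_pairs p hp P hiid (U s) m hs ∅ (fun _ => true) (by simp)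
          simpa [E, hs] using this
        · simp [E, hs]
      calc _ ≤ P (⋃ s, E s) := by
            refine measure_mono ?_
            intro ω hω
            obtain ⟨s, u, hu, hinj, hedge⟩ := long_path Nstar hsym ω x hω (2 * m)
            subst hu
            exact Set.mem_iUnion.2 ⟨s, hinj, fun i hi => hedge (2 * i) (by omega)⟩
        _ ≤ ∑ s, P (E s) := measure_iUnion_fintype_le _ _
        _ ≤ ∑ s : Fin (2 * m) → Nstar, ENNReal.ofReal (1 - (1 - p) ^ 2) ^ m :=
            Finset.sum_le_sum fun s _ => hE s
        _ = r ^ m := by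
            simp [hr, mul_pow, pow_mul]
    exact le_antisymm (ge_of_tendsto' (ENNReal.tendsto_pow_atTop_nhds_zero_of_lt_one hr1) hb)
      zero_le
  rw [← measure_univ (μ := P)]
  exact measure_congr (Filter.eventuallyEq_univ.2 hae)
end

section
/- For every n ≥ 1, the probability that the random graph G contains a self-avoiding path with 2n−1 edges starting at the origin is at most K^{2n−1} (1 − (1−p)²)^n. -/
open MeasureTheory

theorem path_bound {V : Type*} [DecidableEq V] (p : ℝ) (hp : p ∈ Set.Ico (0:ℝ) 1)
    (P : Measure (V → Bool))
    (hiid : ∀ (S : Finset V) (b : V → Bool),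
      P {ω | ∀ x ∈ S, ω x = b x} =
        ∏ x ∈ S, ENNReal.ofReal (if b x then p else 1 - p))
    (x : ℕ → V) (n : ℕ) : ∀ (S : Finset V) (b : V → Bool),
      (∀ i < 2 * n, ∀ j < 2 * n, x i = x j → i = j) → (∀ i < 2 * n, x i ∉ S) →
      P {ω | (∀ y ∈ S, ω y = b y) ∧
          ∀ k < n, ω (x (2 * k)) = true ∨ ω (x (2 * k + 1)) = true} ≤
        (∏ y ∈ S, ENNReal.ofReal (if b y then p else 1 - p)) *
          (ENNReal.ofReal (1 - (1 - p) ^ 2)) ^ n := by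
  induction n with
  | zero =>
    intro S b _ _
    rw [← hiid S b]
    simp
  | succ n ih =>
    intro S b hinj hS
    have huv : x (2 * n) ≠ x (2 * n + 1) := fun h => by
      have := hinj _ (by omega) _ (by omega) h
      omega
    have hu := hS (2 * n) (by omega)
    have hv := hS (2 * n + 1) (by omega)
    have key : ∀ c e : Bool,
        P {ω | ((∀ y ∈ S, ω y = b y) ∧ ω (x (2 * n)) = c ∧ ω (x (2 * n + 1)) = e) ∧
          ∀ k < n, ω (x (2 * k)) = true ∨ ω (x (2 * k + 1)) = true} ≤
        (ENNReal.ofReal (if c then p else 1 - p) * (ENNReal.ofReal (if e then p else 1 - p) *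
        (∏ y ∈ S, ENNReal.ofReal (if b y then p else 1 - p)))) *
          (ENNReal.ofReal (1 - (1 - p) ^ 2)) ^ n := by
      intro c e
      have h := ih (insert (x (2 * n)) (insert (x (2 * n + 1)) S))
        (Function.update (Function.update b (x (2 * n + 1)) e) (x (2 * n)) c)
        (fun i hi j hj => hinj i (by omega) j (by omega)) (by
          intro i hi
          simp only [Finset.mem_insert, not_or]
          refine ⟨fun h => ?_, fun h => ?_, hS i (by omega)⟩
          · have := hinj _ (by omega) _ (by omega) h
            omega
          · have := hinj _ (by omega) _ (by omega) h
            omega)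
      have hne : ∀ y ∈ S, y ≠ x (2 * n) ∧ y ≠ x (2 * n + 1) := fun y hy =>
        ⟨fun h => hu (h ▸ hy), fun h => hv (h ▸ hy)⟩
      rw [Finset.prod_insert (by simp [huv, hu]), Finset.prod_insert hv,
        Finset.prod_congr rfl (g := fun y => ENNReal.ofReal (if b y then p else 1 - p))
          (fun y hy => by
            rw [Function.update_of_ne (hne y hy).1, Function.update_of_ne (hne y hy).2])] at h
      rw [Function.update_self, Function.update_of_ne huv.symm, Function.update_self] at h
      refine le_trans (measure_mono ?_) h
      rintro ω ⟨⟨h1, h2, h3⟩, h4⟩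
      refine ⟨?_, h4⟩
      intro y hy
      rw [Finset.mem_insert, Finset.mem_insert] at hy
      rcases hy with rfl | rfl | hy
      · rw [Function.update_self, h2]
      · rw [Function.update_of_ne huv.symm, Function.update_self, h3]
      · rw [Function.update_of_ne (hne y hy).1, Function.update_of_ne (hne y hy).2, h1 y hy]
    have hq : ENNReal.ofReal (1 - (1 - p) ^ 2) =
        ENNReal.ofReal p * ENNReal.ofReal p + ENNReal.ofReal p * ENNReal.ofReal (1 - p) +
          ENNReal.ofReal (1 - p) * ENNReal.ofReal p := by
      have h0 := hp.1
      have h1 : 0 ≤ 1 - p := by linarith [hp.2]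
      rw [← ENNReal.ofReal_mul h0, ← ENNReal.ofReal_mul h0, ← ENNReal.ofReal_mul h1,
        ← ENNReal.ofReal_add (by positivity) (by positivity),
        ← ENNReal.ofReal_add (by positivity) (by positivity)]
      congr 1
      ring
    refine le_trans (measure_mono ?_) ((measure_union_le _ _).trans
      (add_le_add ((measure_union_le _ _).trans
        (add_le_add (key true true) (key true false))) (key false true)) |>.trans ?_)
    · rintro ω ⟨h1, h2⟩
      have h3 := h2 n (by omega)
      have h4 : ∀ k < n, ω (x (2 * k)) = true ∨ ω (x (2 * k + 1)) = true :=
        fun k hk => h2 k (by omega)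
      cases hc : ω (x (2 * n)) with
      | true =>
        cases he : ω (x (2 * n + 1)) with
        | true => exact Or.inl (Or.inl ⟨⟨h1, hc, he⟩, h4⟩)
        | false => exact Or.inl (Or.inr ⟨⟨h1, hc, he⟩, h4⟩)
      | false =>
        refine Or.inr ⟨⟨h1, hc, ?_⟩, h4⟩
        rcases h3 with h3 | h3
        · rw [hc] at h3
          exact absurd h3 (by decide)
        · exact h3
    · apply le_of_eq
      generalize (∏ y ∈ S, ENNReal.ofReal (if b y = true then p else 1 - p)) = A
      simp only [if_true, Bool.false_eq_true, if_false]
      rw [hq, pow_succ _ n]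
      ring

/-- For every `n ≥ 1`, the probability that the random graph contains a self-avoiding
path with `2n − 1` edges (i.e. `2n` vertices `x_0, …, x_{2n-1}`) starting at the origin
is at most `K^{2n-1} (1 − (1−p)²)^n`. -/
theorem stmt3
    (d : ℕ) (hd : 1 ≤ d)
    (N : Finset (Fin d → ℤ)) (hN : N.Nonempty)
    (Nstar : Finset (Fin d → ℤ)) (hNstar : Nstar = N ∪ N.image (fun z => -z))
    (p : ℝ) (hp : p ∈ Set.Ico (0:ℝ) 1)
    (P : Measure ((Fin d → ℤ) → Bool)) [IsProbabilityMeasure P]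
    (hiid : ∀ (S : Finset (Fin d → ℤ)) (b : (Fin d → ℤ) → Bool),
      P {ω | ∀ x ∈ S, ω x = b x} =
        ∏ x ∈ S, ENNReal.ofReal (if b x then p else 1 - p))
    (n : ℕ) (hn : 1 ≤ n) :
    P {ω | ∃ x : ℕ → (Fin d → ℤ), x 0 = 0 ∧
        (∀ i < 2 * n, ∀ j < 2 * n, x i = x j → i = j) ∧
        (∀ i : ℕ, i + 1 < 2 * n → Adj Nstar ω (x i) (x (i + 1)))}
      ≤ (Nstar.card : ENNReal) ^ (2 * n - 1) * (ENNReal.ofReal (1 - (1 - p) ^ 2)) ^ n := by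
  set T := Fin (2 * n - 1) → Nstar
  let path : T → ℕ → (Fin d → ℤ) := fun s i =>
    ∑ j ∈ Finset.range i, if h : j < 2 * n - 1 then (s ⟨j, h⟩ : Fin d → ℤ) else 0
  have hE : ∀ s : T, P {ω | (∀ i < 2 * n, ∀ j < 2 * n, path s i = path s j → i = j) ∧
      ∀ k < n, ω (path s (2 * k)) = true ∨ ω (path s (2 * k + 1)) = true} ≤
      (ENNReal.ofReal (1 - (1 - p) ^ 2)) ^ n := by
    intro s
    by_cases hs : ∀ i < 2 * n, ∀ j < 2 * n, path s i = path s j → i = j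
    · have := path_bound p hp P hiid (path s) n ∅ (fun _ => true) hs (by simp)
      rw [Finset.prod_empty, one_mul] at this
      refine le_trans (measure_mono ?_) this
      rintro ω ⟨_, h⟩
      exact ⟨by simp, h⟩
    · refine le_trans (measure_mono (t := ∅) ?_) (by simp)
      rintro ω ⟨h, _⟩
      exact hs h
  calc _ ≤ P (⋃ s : T, {ω | (∀ i < 2 * n, ∀ j < 2 * n, path s i = path s j → i = j) ∧
      ∀ k < n, ω (path s (2 * k)) = true ∨ ω (path s (2 * k + 1)) = true}) := by
        apply measure_mono
        rintro ω ⟨x, hx0, hinj, hadj⟩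
        rw [Set.mem_iUnion]
        let s : T := fun j => ⟨x (j + 1) - x j, (hadj j (by omega)).2.1⟩
        have hpath : ∀ i < 2 * n, path s i = x i := by
          intro i
          induction i with
          | zero => intro _; simp [path, hx0]
          | succ i ih =>
            intro hi
            have h1 := ih (by omega)
            simp only [path] at h1 ⊢
            rw [Finset.sum_range_succ, h1, dif_pos (by omega)]
            simp [s]
        refine ⟨s, fun i hi j hj h => ?_, fun k hk => ?_⟩
        · rw [hpath i hi, hpath j hj] at h
          exact hinj i hi j hj h
        · rw [hpath _ (by omega), hpath _ (by omega)]
          exact (hadj (2 * k) (by omega)).2.2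
    _ ≤ ∑ s : T, (ENNReal.ofReal (1 - (1 - p) ^ 2)) ^ n :=
        (measure_iUnion_fintype_le _ _).trans (Finset.sum_le_sum fun s _ => hE s)
    _ = _ := by
        rw [Finset.sum_const, nsmul_eq_mul]
        simp [T]
end

section
/- The function M is continuous and strictly increasing on [0, r(∞)), M(0) = 0, and M(ψ) → ∞ as ψ ↑ r(∞). Consequently M is a bijection from [0, r(∞)) onto [0, ∞). -/
/-- `R(0) = 1`, `R(k) = r(1)⋯r(k)`. -/
noncomputable def Rfac (r : ℕ → ℝ) (m : ℕ) : ℝ := ∏ i ∈ Finset.range m, r (i + 1)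

/-- `Z(ψ) = Σ_{k≥0} ψ^k / R(k)`. -/
noncomputable def Zfun (r : ℕ → ℝ) (ψ : ℝ) : ℝ := ∑' k : ℕ, ψ ^ k / Rfac r k

/-- `M(ψ) = Z(ψ)⁻¹ Σ_{k≥0} k ψ^k / R(k)`, the mean of `μ_ψ`. -/
noncomputable def Mfun (r : ℕ → ℝ) (ψ : ℝ) : ℝ :=
  (Zfun r ψ)⁻¹ * ∑' k : ℕ, (k : ℝ) * ψ ^ k / Rfac r k

lemma aux_Rfac_pos (r : ℕ → ℝ) (hr1 : 0 < r 1) (hrmono : Monotone r) (k : ℕ) :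
    0 < Rfac r k := by
  unfold Rfac
  apply Finset.prod_pos
  intro i _
  exact hr1.trans_le (hrmono (by omega))

lemma aux_Rfac_succ (r : ℕ → ℝ) (k : ℕ) : Rfac r (k + 1) = Rfac r k * r (k + 1) := by
  unfold Rfac
  rw [Finset.prod_range_succ]

lemma aux_summable_Z (r : ℕ → ℝ) (rinf : ℝ)
    (hr1 : 0 < r 1) (hrmono : Monotone r)
    (hrlim : Filter.Tendsto r Filter.atTop (nhds rinf)) (x : ℝ) (hx : 0 ≤ x) (hx' : x < rinf) :
    Summable (fun k : ℕ => x ^ k / Rfac r k) := by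
  rcases hx.eq_or_lt with rfl | hx
  · refine summable_of_ne_finset_zero (s := {0}) ?_
    intro k hk
    have : k ≠ 0 := by simpa using hk
    simp [this]
  have hinf : 0 < rinf := hx.trans hx'
  have hp := aux_Rfac_pos r hr1 hrmono
  refine summable_of_ratio_test_tendsto_lt_one (l := x / rinf)
    ((div_lt_one hinf).2 hx') ?_ ?_
  · filter_upwards with k
    exact (div_pos (pow_pos hx k) (hp k)).ne'
  · have h1 : Filter.Tendsto (fun k : ℕ => x / r (k + 1)) Filter.atTop (nhds (x / rinf)) :=
      tendsto_const_nhds.div ((Filter.tendsto_add_atTop_iff_nat 1).2 hrlim) hinf.ne'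
    refine h1.congr ?_
    intro k
    have hrk : 0 < r (k + 1) := hr1.trans_le (hrmono (by omega))
    have h2 := hp k
    have h3 := hp (k + 1)
    rw [Real.norm_of_nonneg (by positivity), Real.norm_of_nonneg (by positivity), aux_Rfac_succ]
    field_simp
    ring

lemma aux_summable_S (r : ℕ → ℝ) (rinf : ℝ)
    (hr1 : 0 < r 1) (hrmono : Monotone r)
    (hrlim : Filter.Tendsto r Filter.atTop (nhds rinf)) (x : ℝ) (hx : 0 ≤ x) (hx' : x < rinf) :
    Summable (fun k : ℕ => (k : ℝ) * x ^ k / Rfac r k) := by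
  obtain ⟨y, hxy, hy⟩ := exists_between hx'
  have hy0 : 0 < y := hx.trans_lt hxy
  have hp := aux_Rfac_pos r hr1 hrmono
  have hZ := aux_summable_Z r rinf hr1 hrmono hrlim y hy0.le hy
  obtain ⟨C, hC⟩ := hZ.tendsto_atTop_zero.bddAbove_range
  have hg : Summable (fun k : ℕ => (k : ℝ) ^ 1 * (x / y) ^ k) := by
    apply summable_pow_mul_geometric_of_norm_lt_one
    rw [Real.norm_of_nonneg (by positivity)]
    exact (div_lt_one hy0).2 hxy
  refine Summable.of_nonneg_of_le (fun k => ?_) (fun k => ?_) (hg.mul_right C)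
  · have := hp k
    positivity
  · have h1 : y ^ k / Rfac r k ≤ C := hC ⟨k, rfl⟩
    have h2 : (k : ℝ) * x ^ k / Rfac r k = (k : ℝ) ^ 1 * (x / y) ^ k * (y ^ k / Rfac r k) := by
      have := hp k
      rw [div_pow]
      field_simp
    rw [h2]
    exact mul_le_mul_of_nonneg_left h1 (by positivity)

lemma aux_Z_pos (r : ℕ → ℝ) (rinf : ℝ)
    (hr1 : 0 < r 1) (hrmono : Monotone r)
    (hrlim : Filter.Tendsto r Filter.atTop (nhds rinf)) (x : ℝ) (hx : 0 ≤ x) (hx' : x < rinf) :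
    0 < Zfun r x := by
  have hp := aux_Rfac_pos r hr1 hrmono
  refine (aux_summable_Z r rinf hr1 hrmono hrlim x hx hx').tsum_pos (fun k => ?_) 0 ?_
  · exact div_nonneg (pow_nonneg hx k) (hp k).le
  · have := hp 0
    simp only [pow_zero]
    positivity

lemma aux_M_lower (r : ℕ → ℝ) (rinf : ℝ)
    (hr1 : 0 < r 1) (hrmono : Monotone r)
    (hrlim : Filter.Tendsto r Filter.atTop (nhds rinf)) (x : ℝ) (hx : 0 ≤ x) (hx' : x < rinf) :
    x / (rinf - x) ≤ Mfun r x := by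
  have hp := aux_Rfac_pos r hr1 hrmono
  have hinf : 0 < rinf := hx.trans_lt hx'
  have hZ := aux_summable_Z r rinf hr1 hrmono hrlim x hx hx'
  have hS := aux_summable_S r rinf hr1 hrmono hrlim x hx hx'
  have hZp := aux_Z_pos r rinf hr1 hrmono hrlim x hx hx'
  have key : x / rinf * ((∑' k : ℕ, (k : ℝ) * x ^ k / Rfac r k) + Zfun r x) ≤
      ∑' k : ℕ, (k : ℝ) * x ^ k / Rfac r k := by
    unfold Zfun
    rw [← hS.tsum_add hZ, ← tsum_mul_left]
    have e0 : ∑' k : ℕ, (k : ℝ) * x ^ k / Rfac r k =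
        ∑' k : ℕ, ((k + 1 : ℕ) : ℝ) * x ^ (k + 1) / Rfac r (k + 1) := by
      have h := hS.tsum_eq_zero_add
      rw [Nat.cast_zero, zero_mul, zero_div, zero_add] at h
      exact h
    have hS1 : Summable (fun k : ℕ => ((k + 1 : ℕ) : ℝ) * x ^ (k + 1) / Rfac r (k + 1)) :=
      (summable_nat_add_iff (f := fun k : ℕ => (k : ℝ) * x ^ k / Rfac r k) 1).2 hS
    rw [e0]
    refine Summable.tsum_le_tsum (fun k => ?_) ((hS.add hZ).mul_left _) hS1
    have hrk : 0 < r (k + 1) := hr1.trans_le (hrmono (by omega))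
    have hle : r (k + 1) ≤ rinf := hrmono.ge_of_tendsto hrlim _
    have h2 := hp k
    have e1 : ((k + 1 : ℕ) : ℝ) * x ^ (k + 1) / Rfac r (k + 1) =
        x / r (k + 1) * ((k : ℝ) * x ^ k / Rfac r k + x ^ k / Rfac r k) := by
      rw [aux_Rfac_succ]
      push_cast
      field_simp
      ring
    rw [e1]
    apply mul_le_mul_of_nonneg_right _ (by positivity)
    exact div_le_div_of_nonneg_left hx hrk hle
  unfold Mfun
  set S := ∑' k : ℕ, (k : ℝ) * x ^ k / Rfac r k
  rw [div_mul_eq_mul_div, div_le_iff₀ hinf] at key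
  rw [inv_mul_eq_div, div_le_div_iff₀ (by linarith) hZp]
  linarith

lemma aux_M_zero (r : ℕ → ℝ) : Mfun r 0 = 0 := by
  unfold Mfun
  have : ∀ k : ℕ, (k : ℝ) * 0 ^ k / Rfac r k = 0 := by
    intro k
    rcases k with _ | k <;> simp
  simp [this]

lemma aux_cont (r : ℕ → ℝ) (rinf : ℝ)
    (hr1 : 0 < r 1) (hrmono : Monotone r)
    (hrlim : Filter.Tendsto r Filter.atTop (nhds rinf)) (c : ℕ → ℝ)
    (hc : ∀ k, 0 ≤ c k)
    (hS : ∀ x, 0 ≤ x → x < rinf → Summable (fun k : ℕ => c k * x ^ k / Rfac r k)) :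
    ContinuousOn (fun x => ∑' k : ℕ, c k * x ^ k / Rfac r k) (Set.Ico 0 rinf) := by
  have hp := aux_Rfac_pos r hr1 hrmono
  intro x hx
  obtain ⟨y, hxy, hy⟩ := exists_between hx.2
  have hy0 : 0 < y := hx.1.trans_lt hxy
  have h : ContinuousOn (fun x => ∑' k : ℕ, c k * x ^ k / Rfac r k) (Set.Icc 0 y) := by
    refine continuousOn_tsum (fun k => by fun_prop) (hS y hy0.le hy) ?_
    intro k z hz
    have h2 := hp k
    have h3 := hc k
    have h4 := hz.1
    rw [Real.norm_of_nonneg (by positivity)]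
    have := pow_le_pow_left₀ hz.1 hz.2 k
    gcongr
  refine (h x ⟨hx.1, hxy.le⟩).mono_of_mem_nhdsWithin ?_
  filter_upwards [self_mem_nhdsWithin, mem_nhdsWithin_of_mem_nhds (Iio_mem_nhds hxy)] with z h1 h2
  exact ⟨h1.1, le_of_lt h2⟩

lemma aux_strict (r : ℕ → ℝ) (rinf : ℝ)
    (hr1 : 0 < r 1) (hrmono : Monotone r)
    (hrlim : Filter.Tendsto r Filter.atTop (nhds rinf)) :
    StrictMonoOn (Mfun r) (Set.Ico 0 rinf) := by
  have hp := aux_Rfac_pos r hr1 hrmono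
  intro x hx y hy hxy
  have hy0 : 0 < y := hx.1.trans_lt hxy
  rcases hx.1.eq_or_lt with rfl | hx0
  · rw [aux_M_zero]
    refine lt_of_lt_of_le ?_ (aux_M_lower r rinf hr1 hrmono hrlim y hy.1 hy.2)
    exact div_pos hy0 (sub_pos.2 hy.2)
  have hZx := aux_summable_Z r rinf hr1 hrmono hrlim x hx.1 hx.2
  have hSx := aux_summable_S r rinf hr1 hrmono hrlim x hx.1 hx.2
  have hZy := aux_summable_Z r rinf hr1 hrmono hrlim y hy.1 hy.2
  have hSy := aux_summable_S r rinf hr1 hrmono hrlim y hy.1 hy.2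
  have hZxp := aux_Z_pos r rinf hr1 hrmono hrlim x hx.1 hx.2
  have hZyp := aux_Z_pos r rinf hr1 hrmono hrlim y hy.1 hy.2
  have hm0 : 0 < Mfun r x :=
    (div_pos hx0 (sub_pos.2 hx.2)).trans_le (aux_M_lower r rinf hr1 hrmono hrlim x hx.1 hx.2)
  set m := Mfun r x with hm
  have hq : 1 < y / x := (one_lt_div hx0).2 hxy
  have e1 : (∑' k : ℕ, (k : ℝ) * x ^ k / Rfac r k) - m * Zfun r x = 0 := by
    rw [hm]
    unfold Mfun
    field_simp
    ring
  set t := (y / x) ^ m with ht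
  have hdx := hSx.sub (hZx.mul_left m)
  have hdy := hSy.sub (hZy.mul_left m)
  have e2 : t * ((∑' k : ℕ, (k : ℝ) * x ^ k / Rfac r k) - m * Zfun r x) <
      (∑' k : ℕ, (k : ℝ) * y ^ k / Rfac r k) - m * Zfun r y := by
    unfold Zfun
    rw [← tsum_mul_left, ← tsum_mul_left, ← hSx.tsum_sub (hZx.mul_left m),
      ← hSy.tsum_sub (hZy.mul_left m), ← tsum_mul_left]
    have hdiff : ∀ k : ℕ, ((k : ℝ) * y ^ k / Rfac r k - m * (y ^ k / Rfac r k)) -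
        t * ((k : ℝ) * x ^ k / Rfac r k - m * (x ^ k / Rfac r k)) =
        (x ^ k / Rfac r k) * (((k : ℝ) - m) * ((y / x) ^ (k : ℝ) - t)) := by
      intro k
      have := hp k
      rw [Real.rpow_natCast, div_pow]
      field_simp
    refine Summable.tsum_lt_tsum (i := 0) (fun k => ?_) ?_ (hdx.mul_left t) hdy
    · rw [← sub_nonneg, hdiff]
      have := hp k
      apply mul_nonneg (by positivity)
      rcases le_total (k : ℝ) m with h | h
      · exact mul_nonneg_of_nonpos_of_nonpos (sub_nonpos.2 h)
          (sub_nonpos.2 (Real.rpow_le_rpow_of_exponent_le hq.le h))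
      · exact mul_nonneg (sub_nonneg.2 h)
          (sub_nonneg.2 (Real.rpow_le_rpow_of_exponent_le hq.le h))
    · rw [← sub_pos, hdiff]
      have := hp 0
      apply mul_pos (by positivity)
      apply mul_pos_of_neg_of_neg
      · simpa using hm0
      · exact sub_neg.2 (Real.rpow_lt_rpow_of_exponent_lt hq (by simpa using hm0))
  rw [e1, mul_zero] at e2
  unfold Mfun
  rw [inv_mul_eq_div, lt_div_iff₀ hZyp]
  linarith

/-- `M` is continuous and strictly increasing on `[0, r(∞))`, `M(0) = 0`, and
`M(ψ) → ∞` as `ψ ↑ r(∞)`; consequently `M` is a bijection from `[0, r(∞))` onto `[0, ∞)`. -/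
theorem stmt6
    (r : ℕ → ℝ) (rinf : ℝ)
    (hr0 : r 0 = 0) (hr1 : 0 < r 1) (hrmono : Monotone r)
    (hrlim : Filter.Tendsto r Filter.atTop (nhds rinf)) :
    ContinuousOn (Mfun r) (Set.Ico 0 rinf) ∧
    StrictMonoOn (Mfun r) (Set.Ico 0 rinf) ∧
    Mfun r 0 = 0 ∧
    Filter.Tendsto (Mfun r) (nhdsWithin rinf (Set.Iio rinf)) Filter.atTop ∧
    Set.BijOn (Mfun r) (Set.Ico 0 rinf) (Set.Ici 0) := by
  have hinf : 0 < rinf := hr1.trans_le (hrmono.ge_of_tendsto hrlim 1)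
  have hlow := aux_M_lower r rinf hr1 hrmono hrlim
  have hmono := aux_strict r rinf hr1 hrmono hrlim
  have hzero := aux_M_zero r
  have hcont : ContinuousOn (Mfun r) (Set.Ico 0 rinf) := by
    have h1 := aux_cont r rinf hr1 hrmono hrlim (fun k => (k : ℝ)) (fun k => Nat.cast_nonneg k)
      (aux_summable_S r rinf hr1 hrmono hrlim)
    have h2 := aux_cont r rinf hr1 hrmono hrlim (fun _ => 1) (fun _ => zero_le_one)
      (by simpa only [one_mul] using aux_summable_Z r rinf hr1 hrmono hrlim)
    simp only [one_mul] at h2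
    exact (h2.inv₀ fun x hx => (aux_Z_pos r rinf hr1 hrmono hrlim x hx.1 hx.2).ne').mul h1
  refine ⟨hcont, hmono, hzero, ?_, ?_, hmono.injOn, ?_⟩
  · rw [Filter.tendsto_atTop]
    intro c
    have hc0 : 0 ≤ |c| := abs_nonneg c
    have hlt : |c| * rinf / (1 + |c|) < rinf := by
      rw [div_lt_iff₀ (by linarith)]
      nlinarith
    filter_upwards [self_mem_nhdsWithin, mem_nhdsWithin_of_mem_nhds (Ioi_mem_nhds hlt)] with x h1 h2
    have h1 : x < rinf := h1
    have h2 : |c| * rinf / (1 + |c|) < x := h2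
    have hx0 : 0 ≤ x := le_trans (by positivity) h2.le
    refine le_trans (le_abs_self c) (le_trans ?_ (hlow x hx0 h1))
    rw [le_div_iff₀ (by linarith)]
    rw [div_lt_iff₀ (by linarith)] at h2
    nlinarith
  · intro x hx
    exact (div_nonneg hx.1 (sub_nonneg.2 hx.2.le)).trans (hlow x hx.1 hx.2)
  · intro c hc
    have hc : 0 ≤ c := hc
    set y := c * rinf / (1 + c) with hy
    have hy0 : 0 ≤ y := by positivity
    have hlt : y < rinf := by
      rw [hy, div_lt_iff₀ (by linarith)]
      nlinarith
    have hle : c ≤ Mfun r y := by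
      refine le_trans ?_ (hlow y hy0 hlt)
      rw [le_div_iff₀ (by linarith)]
      have : y * (1 + c) = c * rinf := by
        rw [hy]
        field_simp
      nlinarith
    have hsub : Set.Icc 0 y ⊆ Set.Ico 0 rinf := fun z hz => ⟨hz.1, hz.2.trans_lt hlt⟩
    have := intermediate_value_Icc hy0 (hcont.mono hsub)
    rw [hzero] at this
    obtain ⟨z, hz, hzc⟩ := this ⟨hc, hle⟩
    exact ⟨z, hsub hz, hzc⟩
end

section
/- The function ρ is finite, continuous and strictly increasing on [0, r(∞)c) with ρ(0) = 0, and as φ ↑ r(∞)c the values ρ(φ) increase to ρ* := ∫_{[c,1]} M̄(r(∞)c/α) Q(dα) ∈ [0, ∞], where M̄ agrees with M on [0, r(∞)) and M̄(r(∞)) = ∞ and the integral is taken in the extended sense. In particular, ρ is a bijection from [0, r(∞)c) onto [0, ρ*). -/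
open MeasureTheory

section Helpers
open Filter Set Topology

variable {r : ℕ → ℝ} {rinf : ℝ}

lemma h_rpos (hr1 : 0 < r 1) (hrmono : Monotone r) (i : ℕ) : 0 < r (i + 1) :=
  hr1.trans_le (hrmono (by omega))

lemma h_Rpos (hr1 : 0 < r 1) (hrmono : Monotone r) (k : ℕ) : 0 < Rfac r k :=
  Finset.prod_pos fun i _ => h_rpos hr1 hrmono i

lemma h_rinf (hr1 : 0 < r 1) (hrmono : Monotone r)
    (hrlim : Tendsto r atTop (𝓝 rinf)) : 0 < rinf :=
  hr1.trans_le (hrmono.ge_of_tendsto hrlim 1)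

lemma h_sumA (hr1 : 0 < r 1) (hrmono : Monotone r)
    (hrlim : Tendsto r atTop (𝓝 rinf)) {x : ℝ} (hx : x ∈ Ico 0 rinf) :
    Summable (fun k : ℕ => (k : ℝ) * x ^ k / Rfac r k) := by
  have hri := h_rinf hr1 hrmono hrlim
  rcases hx.1.eq_or_lt with h0 | h0
  · subst h0
    refine summable_of_ne_finset_zero (s := {0}) ?_
    intro b hb
    have : b ≠ 0 := by simpa using hb
    simp [this]
  · refine summable_of_ratio_test_tendsto_lt_one (l := x / rinf) ?_ ?_ ?_
    · rw [div_lt_one hri]; exact hx.2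
    · filter_upwards [eventually_gt_atTop 0] with k hk
      have := h_Rpos hr1 hrmono k
      have : (0 : ℝ) < k := by exact_mod_cast hk
      positivity
    · have h1 : Tendsto (fun k : ℕ => (1 + 1 / (k : ℝ)) * (x / r (k + 1))) atTop
          (𝓝 ((1 + 0) * (x / rinf))) := by
        refine Tendsto.mul (tendsto_const_nhds.add tendsto_one_div_atTop_nhds_zero_nat) ?_
        exact tendsto_const_nhds.div (hrlim.comp (tendsto_add_atTop_nat 1)) hri.ne'
      rw [add_zero, one_mul] at h1
      refine h1.congr' ?_
      filter_upwards [eventually_gt_atTop 0] with k hk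
      have hR := h_Rpos hr1 hrmono k
      have hk' : (0 : ℝ) < k := by exact_mod_cast hk
      have hr := h_rpos hr1 hrmono k
      have e : Rfac r (k + 1) = Rfac r k * r (k + 1) := Finset.prod_range_succ _ _
      have hR' := h_Rpos hr1 hrmono (k+1)
      rw [Real.norm_of_nonneg (by positivity), Real.norm_of_nonneg (by positivity), e]
      push_cast
      field_simp
      ring

lemma h_sumZ (hr1 : 0 < r 1) (hrmono : Monotone r)
    (hrlim : Tendsto r atTop (𝓝 rinf)) {x : ℝ} (hx : x ∈ Ico 0 rinf) :
    Summable (fun k : ℕ => x ^ k / Rfac r k) := by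
  rw [← summable_nat_add_iff 1]
  refine Summable.of_nonneg_of_le ?_ ?_
    ((summable_nat_add_iff 1).2 (h_sumA hr1 hrmono hrlim hx))
  · intro k
    have := h_Rpos hr1 hrmono (k+1)
    have := hx.1
    positivity
  · intro k
    have := h_Rpos hr1 hrmono (k+1)
    have := hx.1
    have h2 : (1 : ℝ) ≤ ((k + 1 : ℕ) : ℝ) := by exact_mod_cast Nat.succ_pos k
    gcongr
    have : 0 ≤ x ^ (k+1) := by positivity
    nlinarith

lemma h_Zpos (hr1 : 0 < r 1) (hrmono : Monotone r)
    (hrlim : Tendsto r atTop (𝓝 rinf)) {x : ℝ} (hx : x ∈ Ico 0 rinf) :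
    0 < Zfun r x := by
  refine (h_sumZ hr1 hrmono hrlim hx).tsum_pos ?_ 0 ?_
  · intro k
    have := h_Rpos hr1 hrmono k
    have := hx.1
    positivity
  · simp [Rfac]

/-- numerator -/
noncomputable def Anum (r : ℕ → ℝ) (x : ℝ) : ℝ := ∑' k : ℕ, (k : ℝ) * x ^ k / Rfac r k

lemma h_M (x : ℝ) : Mfun r x = (Zfun r x)⁻¹ * Anum r x := rfl

lemma h_contA (hr1 : 0 < r 1) (hrmono : Monotone r)
    (hrlim : Tendsto r atTop (𝓝 rinf)) :
    ContinuousOn (Mfun r) (Ico 0 rinf) := by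
  intro x hx
  obtain ⟨b, hxb, hb⟩ := exists_between hx.2
  have hb0 : 0 ≤ b := hx.1.trans hxb.le
  have hbI : b ∈ Ico 0 rinf := ⟨hb0, hb⟩
  have hmem : Icc 0 b ∈ 𝓝[Ico 0 rinf] x := by
    filter_upwards [self_mem_nhdsWithin, nhdsWithin_le_nhds (Iio_mem_nhds hxb)] with y hy hy2
    exact ⟨hy.1, le_of_lt hy2⟩
  have cA : ContinuousOn (Anum r) (Icc 0 b) := by
    refine continuousOn_tsum (u := fun k : ℕ => (k : ℝ) * b ^ k / Rfac r k) ?_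
      (h_sumA hr1 hrmono hrlim hbI) ?_
    · intro k; fun_prop
    · intro k y hy
      have := h_Rpos hr1 hrmono k
      have hy1 := hy.1
      have hy2 := hy.2
      rw [Real.norm_of_nonneg (by positivity)]
      gcongr
  have cZ : ContinuousOn (Zfun r) (Icc 0 b) := by
    refine continuousOn_tsum (u := fun k : ℕ => b ^ k / Rfac r k) ?_
      (h_sumZ hr1 hrmono hrlim hbI) ?_
    · intro k; fun_prop
    · intro k y hy
      have := h_Rpos hr1 hrmono k
      have hy1 := hy.1
      have hy2 := hy.2
      rw [Real.norm_of_nonneg (by positivity)]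
      gcongr
  have cM : ContinuousOn (Mfun r) (Icc 0 b) :=
    (cZ.inv₀ fun y hy =>
      (h_Zpos hr1 hrmono hrlim ⟨hy.1, hy.2.trans_lt hb⟩).ne').mul cA
  exact (cM x ⟨hx.1, hxb.le⟩).mono_of_mem_nhdsWithin hmem

lemma h_M0 : Mfun r 0 = 0 := by
  have : ∀ k : ℕ, (k : ℝ) * 0 ^ k / Rfac r k = 0 := by
    intro k
    rcases Nat.eq_zero_or_pos k with h | h
    · simp [h]
    · simp [h.ne']
  simp [Mfun, this]

lemma h_Mnonneg (hr1 : 0 < r 1) (hrmono : Monotone r) {x : ℝ} (hx : 0 ≤ x) :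
    0 ≤ Mfun r x := by
  have : ∀ k, 0 < Rfac r k := h_Rpos hr1 hrmono
  refine mul_nonneg (inv_nonneg.2 (tsum_nonneg fun k => ?_)) (tsum_nonneg fun k => ?_) <;>
  · have := this k
    positivity

/-- `∑ (k - m) y^k / R k = A(y) - m Z(y)`. -/
lemma h_hasSum (hr1 : 0 < r 1) (hrmono : Monotone r)
    (hrlim : Tendsto r atTop (𝓝 rinf)) {x : ℝ} (hx : x ∈ Ico 0 rinf) (m : ℝ) :
    HasSum (fun k : ℕ => ((k : ℝ) - m) * (x ^ k / Rfac r k)) (Anum r x - m * Zfun r x) := by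
  have h1 := (h_sumA hr1 hrmono hrlim hx).hasSum
  have h2 := ((h_sumZ hr1 hrmono hrlim hx).hasSum).mul_left m
  have e : (fun k : ℕ => ((k : ℝ) - m) * (x ^ k / Rfac r k)) =
      fun k : ℕ => (k : ℝ) * x ^ k / Rfac r k - m * (x ^ k / Rfac r k) := by
    funext k; ring
  rw [e]
  exact h1.sub h2

lemma h_Mstrict (hr1 : 0 < r 1) (hrmono : Monotone r)
    (hrlim : Tendsto r atTop (𝓝 rinf)) : StrictMonoOn (Mfun r) (Ico 0 rinf) := by
  intro x hx y hy hxy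
  have hZy := h_Zpos hr1 hrmono hrlim hy
  have hy0 : 0 < y := hx.1.trans_lt hxy
  have key : 0 < Anum r y - Mfun r x * Zfun r y := by
    rcases hx.1.eq_or_lt with h0 | h0
    · rw [← h0, h_M0, zero_mul, sub_zero]
      refine (h_sumA hr1 hrmono hrlim hy).tsum_pos ?_ 1 ?_
      · intro k
        have := h_Rpos hr1 hrmono k
        positivity
      · have := h_Rpos hr1 hrmono 1
        positivity
    · set m := Mfun r x with hm
      have hm0 : 0 ≤ m := h_Mnonneg hr1 hrmono hx.1
      have hZx := h_Zpos hr1 hrmono hrlim hx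
      have hsx := h_hasSum hr1 hrmono hrlim hx m
      have e0 : Anum r x - m * Zfun r x = 0 := by
        rw [hm, h_M]; field_simp; ring
      rw [e0] at hsx
      set n := ⌊m⌋₊ with hn
      have hsx' := hsx.mul_left ((y / x) ^ n)
      rw [mul_zero] at hsx'
      have ht : 1 < y / x := (one_lt_div h0).2 hxy
      have hyx : ∀ k : ℕ, y ^ k = (y / x) ^ k * x ^ k := by
        intro k; rw [← mul_pow]; congr 1; field_simp
      refine hasSum_lt (i := n + 1) ?_ ?_ hsx' (h_hasSum hr1 hrmono hrlim hy m)
      · intro k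
        have hR := h_Rpos hr1 hrmono k
        have : 0 ≤ ((k:ℝ) - m) * ((y/x)^k - (y/x)^n) := by
          rcases le_or_gt k n with h | h
          · have h1 : (k : ℝ) ≤ m := (Nat.le_floor_iff hm0).1 h
            have h2 : (y/x)^k ≤ (y/x)^n := pow_le_pow_right₀ ht.le h
            nlinarith
          · have h1 : m < k := (Nat.floor_lt hm0).1 h
            have h2 : (y/x)^n ≤ (y/x)^k := pow_le_pow_right₀ ht.le h.le
            nlinarith
        have h3 : 0 ≤ x ^ k / Rfac r k := by positivity
        have h4 := mul_nonneg this h3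
        simp only
        rw [hyx k]
        have : (y / x) ^ k * x ^ k / Rfac r k = (y/x)^k * (x ^ k / Rfac r k) := by ring
        rw [this]
        linarith
      · have hR := h_Rpos hr1 hrmono (n+1)
        have : 0 < (((n+1 : ℕ):ℝ) - m) * ((y/x)^(n+1) - (y/x)^n) := by
          have h1 : m < (n + 1 : ℕ) := (Nat.floor_lt hm0).1 (Nat.lt_succ_self _)
          have h2 : (y/x)^n < (y/x)^(n+1) := pow_lt_pow_right₀ ht (Nat.lt_succ_self _)
          exact mul_pos (sub_pos.2 h1) (sub_pos.2 h2)
        have h3 : 0 < x ^ (n+1) / Rfac r (n+1) := by positivity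
        have h4 := mul_pos this h3
        rw [hyx (n+1)]
        have : (y / x) ^ (n+1) * x ^ (n+1) / Rfac r (n+1)
          = (y/x)^(n+1) * (x ^ (n+1) / Rfac r (n+1)) := by ring
        rw [this]
        linarith
  rw [h_M y, inv_mul_eq_div, lt_div_iff₀ hZy]
  linarith

lemma h_Rle (hr1 : 0 < r 1) (hrmono : Monotone r)
    (hrlim : Tendsto r atTop (𝓝 rinf)) (k : ℕ) : 1 ≤ rinf ^ k / Rfac r k := by
  rw [one_le_div (h_Rpos hr1 hrmono k)]
  have : rinf ^ k = ∏ i ∈ Finset.range k, rinf := by simp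
  rw [this]
  exact Finset.prod_le_prod (fun i _ => (h_rpos hr1 hrmono i).le)
    fun i _ => hrmono.ge_of_tendsto hrlim _

lemma h_unbdd (hr1 : 0 < r 1) (hrmono : Monotone r)
    (hrlim : Tendsto r atTop (𝓝 rinf)) (K : ℕ) : ∃ x ∈ Ico 0 rinf, (K : ℝ) < Mfun r x := by
  by_contra! hcon
  have hri := h_rinf hr1 hrmono hrlim
  set B : ℝ := ∑ k ∈ Finset.range (K+2), (K + 1 : ℝ) * (rinf ^ k / Rfac r k) with hB
  have hZ : ∀ x ∈ Ico 0 rinf, Zfun r x ≤ B := by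
    intro x hx
    have hZx := h_Zpos hr1 hrmono hrlim hx
    have h1 := hcon x hx
    rw [h_M, inv_mul_eq_div, div_le_iff₀ hZx] at h1
    have hs := h_hasSum hr1 hrmono hrlim hx K
    have hf : HasSum (fun k : ℕ => if k ∈ Finset.range (K+2) then
        (K + 1 : ℝ) * (rinf ^ k / Rfac r k) else 0) B := by
      have := hasSum_sum_of_ne_finset_zero (L := SummationFilter.unconditional ℕ) (f := fun k : ℕ => if k ∈ Finset.range (K+2) then
        (K + 1 : ℝ) * (rinf ^ k / Rfac r k) else 0) (s := Finset.range (K+2))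
        (fun b hb => if_neg hb)
      convert this using 1
      exact Finset.sum_congr rfl fun k hk => (if_pos hk).symm
    have hle := hasSum_le (fun k => ?_) (h_sumZ hr1 hrmono hrlim hx).hasSum (hs.add hf)
    · have : Zfun r x ≤ Anum r x - K * Zfun r x + B := hle
      linarith
    · have hR := h_Rpos hr1 hrmono k
      have hx0 := hx.1
      have h3 : 0 ≤ x ^ k / Rfac r k := by positivity
      have h4 : x ^ k / Rfac r k ≤ rinf ^ k / Rfac r k := by
        have := hx.2.le
        gcongr
      split_ifs with hk
      · have : (0:ℝ) ≤ k := Nat.cast_nonneg _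
        have : (0:ℝ) ≤ K := Nat.cast_nonneg _
        nlinarith [mul_nonneg ‹(0:ℝ) ≤ k› h3]
      · have : ((K + 2 : ℕ) : ℝ) ≤ k := by
          have : K + 2 ≤ k := by simpa using hk
          exact_mod_cast this
        push_cast at this
        nlinarith
  obtain ⟨n, hn⟩ := exists_nat_gt B
  have hP : Tendsto (fun x : ℝ => ∑ k ∈ Finset.range n, x ^ k / Rfac r k) (𝓝[<] rinf)
      (𝓝 (∑ k ∈ Finset.range n, rinf ^ k / Rfac r k)) := by
    have : Continuous (fun x : ℝ => ∑ k ∈ Finset.range n, x ^ k / Rfac r k) := by fun_prop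
    exact (this.tendsto rinf).mono_left nhdsWithin_le_nhds
  have h5 : ∑ k ∈ Finset.range n, rinf ^ k / Rfac r k ≤ B := by
    refine le_of_tendsto hP ?_
    filter_upwards [Ioo_mem_nhdsLT hri] with x hx
    refine ((h_sumZ hr1 hrmono hrlim ⟨hx.1.le, hx.2⟩).sum_le_tsum _ ?_).trans
      (hZ x ⟨hx.1.le, hx.2⟩)
    intro k _
    have hR := h_Rpos hr1 hrmono k
    have := hx.1
    positivity
  have h6 : (n : ℝ) ≤ ∑ k ∈ Finset.range n, rinf ^ k / Rfac r k := by
    calc (n : ℝ) = ∑ k ∈ Finset.range n, (1:ℝ) := by simp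
      _ ≤ _ := Finset.sum_le_sum fun k _ => h_Rle hr1 hrmono hrlim k
  linarith

end Helpers

/-- The density `ρ(φ) = ∫_{[c,1]} M(φ/α) Q(dα)` is finite, continuous and strictly
increasing on `[0, r(∞)c)` with `ρ(0) = 0`, and as `φ ↑ r(∞)c` it increases to
`ρ* = ∫_{[c,1]} M̄(r(∞)c/α) Q(dα) ∈ [0,∞]` (extended-sense integral, `M̄ = M` on
`[0,r(∞))`, `M̄(r(∞)) = ∞`); in particular `ρ` is a bijection from `[0, r(∞)c)`
onto `[0, ρ*)`. -/
theorem stmt8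
    (r : ℕ → ℝ) (rinf : ℝ)
    (hr0 : r 0 = 0) (hr1 : 0 < r 1) (hrmono : Monotone r)
    (hrlim : Filter.Tendsto r Filter.atTop (nhds rinf))
    (c : ℝ) (hc : c ∈ Set.Ioc (0:ℝ) 1)
    (Q : Measure ℝ) [IsProbabilityMeasure Q] (hQ : Q (Set.Icc c 1) = 1)
    (ρ : ℝ → ℝ) (hρ : ∀ φ, ρ φ = ∫ a in Set.Icc c 1, Mfun r (φ / a) ∂Q)
    (ρstar : ENNReal)
    (hρstar : ρstar = ∫⁻ a in Set.Icc c 1,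
        (if rinf * c / a < rinf then ENNReal.ofReal (Mfun r (rinf * c / a)) else ⊤) ∂Q) :
    (∀ φ ∈ Set.Ico 0 (rinf * c),
        IntegrableOn (fun a => Mfun r (φ / a)) (Set.Icc c 1) Q) ∧
    ContinuousOn ρ (Set.Ico 0 (rinf * c)) ∧
    StrictMonoOn ρ (Set.Ico 0 (rinf * c)) ∧
    ρ 0 = 0 ∧
    Filter.Tendsto (fun φ => ENNReal.ofReal (ρ φ))
      (nhdsWithin (rinf * c) (Set.Iio (rinf * c))) (nhds ρstar) ∧
    Set.BijOn ρ (Set.Ico 0 (rinf * c)) {x : ℝ | 0 ≤ x ∧ ENNReal.ofReal x < ρstar} := by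
  have hri := h_rinf hr1 hrmono hrlim
  have hc0 : 0 < c := hc.1
  have hrc : 0 < rinf * c := mul_pos hri hc0
  have hMc := h_contA hr1 hrmono hrlim
  have hMs := h_Mstrict hr1 hrmono hrlim
  have hmem : ∀ φ ∈ Set.Ico 0 (rinf * c), ∀ a ∈ Set.Icc c 1, φ / a ∈ Set.Ico 0 rinf := by
    intro φ hφ a ha
    have ha0 : 0 < a := hc0.trans_le ha.1
    refine ⟨div_nonneg hφ.1 ha0.le, ?_⟩
    rw [div_lt_iff₀ ha0]
    exact hφ.2.trans_le (mul_le_mul_of_nonneg_left ha.1 hri.le)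
  have hInteg : ∀ φ ∈ Set.Ico 0 (rinf * c),
        IntegrableOn (fun a => Mfun r (φ / a)) (Set.Icc c 1) Q := by
    intro φ hφ
    refine ContinuousOn.integrableOn_compact isCompact_Icc ?_
    refine hMc.comp ?_ (fun a ha => hmem φ hφ a ha)
    exact continuousOn_const.div continuousOn_id fun a ha => (hc0.trans_le ha.1).ne'
  have hρnn : ∀ φ ∈ Set.Ico 0 (rinf * c), 0 ≤ ρ φ := by
    intro φ hφ
    rw [hρ]
    exact setIntegral_nonneg measurableSet_Icc fun a ha =>
      h_Mnonneg hr1 hrmono (hmem φ hφ a ha).1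
  have hcont : ContinuousOn ρ (Set.Ico 0 (rinf * c)) := by
    rw [show ρ = fun φ => ∫ a in Set.Icc c 1, Mfun r (φ / a) ∂Q from funext hρ]
    intro φ hφ
    obtain ⟨b, hb1, hb2⟩ := exists_between hφ.2
    have hbI : b ∈ Set.Ico 0 (rinf * c) := ⟨hφ.1.trans hb1.le, hb2⟩
    refine continuousWithinAt_of_dominated (bound := fun a => Mfun r (b / a)) ?_ ?_
      (hInteg b hbI) ?_
    · filter_upwards [self_mem_nhdsWithin] with y hy using (hInteg y hy).1
    · filter_upwards [self_mem_nhdsWithin, nhdsWithin_le_nhds (Iio_mem_nhds hb1)] with y hy hy2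
      filter_upwards [ae_restrict_mem measurableSet_Icc] with a ha
      have ha0 : 0 < a := hc0.trans_le ha.1
      rw [Real.norm_of_nonneg (h_Mnonneg hr1 hrmono (hmem y hy a ha).1)]
      refine hMs.monotoneOn (hmem y hy a ha) (hmem b hbI a ha) ?_
      have : y ≤ b := le_of_lt hy2
      gcongr
    · filter_upwards [ae_restrict_mem measurableSet_Icc] with a ha
      refine ContinuousWithinAt.comp (f := fun y => y / a) (t := Set.Ico 0 rinf)
        (hMc _ (hmem φ hφ a ha)) ?_
        (fun y hy => hmem y hy a ha)
      exact (continuous_id.div_const a).continuousWithinAt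
  have hstrict : StrictMonoOn ρ (Set.Ico 0 (rinf * c)) := by
    intro x hx y hy hxy
    rw [← sub_pos, hρ, hρ, ← integral_sub (hInteg y hy) (hInteg x hx)]
    have hp : ∀ a ∈ Set.Icc c 1, 0 < Mfun r (y / a) - Mfun r (x / a) := by
      intro a ha
      have ha0 : 0 < a := hc0.trans_le ha.1
      refine sub_pos.2 (hMs (hmem x hx a ha) (hmem y hy a ha) ?_)
      gcongr
    rw [setIntegral_pos_iff_support_of_nonneg_ae]
    · have : (Function.support fun a => Mfun r (y / a) - Mfun r (x / a)) ∩ Set.Icc c 1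
          = Set.Icc c 1 := Set.inter_eq_right.2 fun a ha => (hp a ha).ne'
      rw [this, hQ]
      exact one_pos
    · filter_upwards [ae_restrict_mem measurableSet_Icc] with a ha using (hp a ha).le
    · exact (hInteg y hy).sub (hInteg x hx)
  have hzero : ρ 0 = 0 := by
    rw [hρ]; simp [h_M0]
  have hlin : ∀ φ ∈ Set.Ico 0 (rinf * c), ENNReal.ofReal (ρ φ) =
      ∫⁻ a in Set.Icc c 1, ENNReal.ofReal (Mfun r (φ / a)) ∂Q := by
    intro φ hφ
    rw [hρ]
    refine ofReal_integral_eq_lintegral_ofReal (hInteg φ hφ) ?_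
    filter_upwards [ae_restrict_mem measurableSet_Icc] with a ha using
      h_Mnonneg hr1 hrmono (hmem φ hφ a ha).1
  have hle : ∀ φ ∈ Set.Ico 0 (rinf * c), ENNReal.ofReal (ρ φ) ≤ ρstar := by
    intro φ hφ
    rw [hlin φ hφ, hρstar]
    refine setLIntegral_mono' measurableSet_Icc fun a ha => ?_
    have ha0 : 0 < a := hc0.trans_le ha.1
    split_ifs with h
    · refine ENNReal.ofReal_le_ofReal (hMs.monotoneOn (hmem φ hφ a ha) ⟨by positivity, h⟩ ?_)
      have := hφ.2.le
      gcongr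
    · exact le_top
  obtain ⟨u, hu_mono, hu_mem, hu_lim⟩ := exists_seq_strictMono_tendsto' hrc
  have huI : ∀ n, u n ∈ Set.Ico 0 (rinf * c) := fun n => ⟨(hu_mem n).1.le, (hu_mem n).2⟩
  have hseq : Filter.Tendsto (fun n => ENNReal.ofReal (ρ (u n))) Filter.atTop (nhds ρstar) := by
    simp_rw [fun n => hlin (u n) (huI n)]
    rw [hρstar]
    refine lintegral_tendsto_of_tendsto_of_monotone ?_ ?_ ?_
    · intro n
      exact (hInteg (u n) (huI n)).1.aemeasurable.ennreal_ofReal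
    · filter_upwards [ae_restrict_mem measurableSet_Icc] with a ha
      intro n m hnm
      have ha0 : 0 < a := hc0.trans_le ha.1
      refine ENNReal.ofReal_le_ofReal (hMs.monotoneOn (hmem _ (huI n) a ha)
        (hmem _ (huI m) a ha) ?_)
      have := hu_mono.monotone hnm
      gcongr
    · filter_upwards [ae_restrict_mem measurableSet_Icc] with a ha
      have ha0 : 0 < a := hc0.trans_le ha.1
      have hl : Filter.Tendsto (fun n => u n / a) Filter.atTop (nhds (rinf * c / a)) :=
        hu_lim.div_const a
      split_ifs with h
      · refine ENNReal.tendsto_ofReal ?_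
        have hw : ContinuousWithinAt (Mfun r) (Set.Ico 0 rinf) (rinf * c / a) :=
          hMc _ ⟨by positivity, h⟩
        exact hw.tendsto.comp (tendsto_nhdsWithin_iff.2
          ⟨hl, Filter.Eventually.of_forall fun n => hmem _ (huI n) a ha⟩)
      · refine ENNReal.tendsto_ofReal_nhds_top.2 ?_
        rw [Filter.tendsto_atTop]
        intro B
        obtain ⟨K, hK⟩ := exists_nat_gt B
        obtain ⟨x, hx, hxK⟩ := h_unbdd hr1 hrmono hrlim K
        have hxl : x < rinf * c / a := hx.2.trans_le (not_lt.1 h)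
        filter_upwards [hl.eventually_const_lt hxl] with n hn
        exact (hK.trans (hxK.trans (hMs hx (hmem _ (huI n) a ha) hn))).le
  have htend : Filter.Tendsto (fun φ => ENNReal.ofReal (ρ φ))
      (nhdsWithin (rinf * c) (Set.Iio (rinf * c))) (nhds ρstar) := by
    rw [tendsto_order]
    constructor
    · intro l hl
      obtain ⟨n, hn⟩ := (hseq.eventually_const_lt hl).exists
      filter_upwards [Ioo_mem_nhdsLT (hu_mem n).2] with φ hφ
      exact hn.trans_le (ENNReal.ofReal_le_ofReal (hstrict.monotoneOn (huI n)
        ⟨(huI n).1.trans hφ.1.le, hφ.2⟩ hφ.1.le))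
    · intro l hl
      filter_upwards [Ioo_mem_nhdsLT hrc] with φ hφ
      exact (hle φ ⟨hφ.1.le, hφ.2⟩).trans_lt hl
  refine ⟨hInteg, hcont, hstrict, hzero, htend, ?_, hstrict.injOn, ?_⟩
  · intro φ hφ
    refine ⟨hρnn φ hφ, ?_⟩
    obtain ⟨b, hb1, hb2⟩ := exists_between hφ.2
    have hbI : b ∈ Set.Ico 0 (rinf * c) := ⟨hφ.1.trans hb1.le, hb2⟩
    have hlt := hstrict hφ hbI hb1
    exact ((ENNReal.ofReal_lt_ofReal_iff ((hρnn φ hφ).trans_lt hlt)).2 hlt).trans_le (hle b hbI)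
  · rintro x ⟨hx0, hx⟩
    obtain ⟨n, hn⟩ := (hseq.eventually_const_lt hx).exists
    have hxn : x < ρ (u n) := (ENNReal.ofReal_lt_ofReal_iff_of_nonneg hx0).1 hn
    have hsub : Set.Icc 0 (u n) ⊆ Set.Ico 0 (rinf * c) := fun y hy =>
      ⟨hy.1, hy.2.trans_lt (huI n).2⟩
    have hivt := intermediate_value_Icc (huI n).1 (hcont.mono hsub)
    obtain ⟨y, hy, hyx⟩ := hivt ⟨by rw [hzero]; exact hx0, hxn.le⟩
    exact ⟨y, hsub hy, hyx⟩
end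

section
/- In the geometric case, define the flux function f : [0,∞) → [0,c] by f(u) = sup{ φ ∈ [0, c) : ρ(φ) ≤ u } (the set is nonempty since ρ(0) = 0). Then f is nondecreasing and concave on [0, ∞), f(ρ(φ)) = φ for every φ ∈ [0, c), and if ρ* := lim_{φ ↑ c} ρ(φ) < ∞ then f(u) = c for every u ≥ ρ*. -/
open MeasureTheory

/-- In the geometric case, the flux `f(u) = sup{φ ∈ [0,c) : ρ(φ) ≤ u}` is
nondecreasing and concave on `[0,∞)`, satisfies `f(ρ(φ)) = φ` for every
`φ ∈ [0,c)`, and if `ρ* = lim_{φ ↑ c} ρ(φ) < ∞` then `f(u) = c` for all `u ≥ ρ*`. -/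
theorem stmt12
    (c : ℝ) (hc : c ∈ Set.Ioc (0:ℝ) 1)
    (Q : Measure ℝ) [IsProbabilityMeasure Q] (hQ : Q (Set.Icc c 1) = 1)
    (ρ : ℝ → ℝ) (hρ : ∀ φ, ρ φ = ∫ a in Set.Icc c 1, φ / (a - φ) ∂Q)
    (f : ℝ → ℝ) (hf : ∀ u, f u = sSup {φ : ℝ | φ ∈ Set.Ico 0 c ∧ ρ φ ≤ u}) :
    MonotoneOn f (Set.Ici 0) ∧
    ConcaveOn ℝ (Set.Ici 0) f ∧
    (∀ φ ∈ Set.Ico 0 c, f (ρ φ) = φ) ∧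
    (∀ ρs : ℝ, Filter.Tendsto ρ (nhdsWithin c (Set.Iio c)) (nhds ρs) →
      ∀ u : ℝ, ρs ≤ u → f u = c) := by
  obtain ⟨hc0, hc1⟩ := hc
  have hint : ∀ φ, φ < c → IntegrableOn (fun a : ℝ => φ / (a - φ)) (Set.Icc c 1) Q := by
    intro φ h
    apply ContinuousOn.integrableOn_compact isCompact_Icc
    apply ContinuousOn.div (by fun_prop) (by fun_prop)
    intro a ha
    have := ha.1
    exact ne_of_gt (by linarith)
  have hmono : ∀ φ ψ, 0 ≤ φ → φ ≤ ψ → ψ < c → ρ φ + c * (ψ - φ) ≤ ρ ψ := by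
    intro φ ψ h0 h1 h2
    have e : c * (ψ - φ) = ∫ a in Set.Icc c 1, c * (ψ - φ) ∂Q := by
      simp [Measure.real, hQ]
    rw [hρ φ, hρ ψ, e, ← integral_add (hint φ (by linarith)) (integrable_const _)]
    apply setIntegral_mono_on ((hint φ (by linarith)).add (integrable_const _)) (hint ψ h2)
      measurableSet_Icc
    intro a ⟨ha1, ha2⟩
    have hx : 0 < a - φ := by linarith
    have hy : 0 < a - ψ := by linarith
    have key : ψ / (a - ψ) - φ / (a - φ) = a * (ψ - φ) / ((a - φ) * (a - ψ)) := by
      field_simp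
      ring
    have : c * (ψ - φ) ≤ a * (ψ - φ) / ((a - φ) * (a - ψ)) := by
      rw [le_div_iff₀ (by positivity)]
      have h3 : (a - φ) * (a - ψ) ≤ 1 := by
        apply mul_le_one₀ <;> linarith
      have h4 : 0 ≤ c * (ψ - φ) := mul_nonneg hc0.le (by linarith)
      have h5 : c * (ψ - φ) ≤ a * (ψ - φ) := mul_le_mul_of_nonneg_right ha1 (by linarith)
      nlinarith [mul_le_mul_of_nonneg_left h3 h4]
    show φ / (a - φ) + c * (ψ - φ) ≤ ψ / (a - ψ)
    linarith
  have hconv : ∀ φ ψ s t, 0 ≤ φ → 0 ≤ ψ → φ < c → ψ < c → 0 ≤ s → 0 ≤ t → s + t = 1 →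
      s * φ + t * ψ < c → ρ (s * φ + t * ψ) ≤ s * ρ φ + t * ρ ψ := by
    intro φ ψ s t h0 h1 h2 h3 hs ht hst hlt
    rw [hρ φ, hρ ψ, hρ (s * φ + t * ψ), ← integral_const_mul, ← integral_const_mul,
      ← integral_add ((hint φ h2).const_mul s) ((hint ψ h3).const_mul t)]
    apply setIntegral_mono_on (hint _ hlt)
      (((hint φ h2).const_mul s).add ((hint ψ h3).const_mul t)) measurableSet_Icc
    intro a ⟨ha1, ha2⟩
    have hx : 0 < a - φ := by linarith
    have hy : 0 < a - ψ := by linarith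
    have hz : 0 < a - (s * φ + t * ψ) := by linarith
    have ha : 0 < a := by linarith
    have key : s * (φ / (a - φ)) + t * (ψ / (a - ψ)) - (s * φ + t * ψ) / (a - (s * φ + t * ψ))
        = a * s * t * (φ - ψ) ^ 2 / ((a - φ) * (a - ψ) * (a - (s * φ + t * ψ))) := by
      obtain rfl : t = 1 - s := by linarith
      field_simp
      ring
    have : 0 ≤ a * s * t * (φ - ψ) ^ 2 / ((a - φ) * (a - ψ) * (a - (s * φ + t * ψ))) := by
      positivity
    show (s * φ + t * ψ) / (a - (s * φ + t * ψ)) ≤ s * (φ / (a - φ)) + t * (ψ / (a - ψ))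
    linarith
  have hρ0 : ρ 0 = 0 := by simp [hρ]
  have hbdd : ∀ u, BddAbove {φ : ℝ | φ ∈ Set.Ico 0 c ∧ ρ φ ≤ u} :=
    fun u => ⟨c, fun φ h => h.1.2.le⟩
  have hne : ∀ u, 0 ≤ u → {φ : ℝ | φ ∈ Set.Ico 0 c ∧ ρ φ ≤ u}.Nonempty :=
    fun u hu => ⟨0, ⟨le_refl _, hc0⟩, by rw [hρ0]; exact hu⟩
  refine ⟨?_, ⟨convex_Ici 0, ?_⟩, ?_, ?_⟩
  · intro u hu v hv huv
    rw [hf, hf]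
    exact csSup_le_csSup (hbdd v) (hne u hu) fun φ h => ⟨h.1, h.2.trans huv⟩
  · intro u hu v hv s t hs ht hst
    simp only [smul_eq_mul]
    apply le_of_forall_pos_sub_le
    intro ε hε
    obtain ⟨φ, hφ, hφ'⟩ := exists_lt_of_lt_csSup (hne u hu) (b := f u - ε) (by rw [← hf]; linarith)
    obtain ⟨ψ, hψ, hψ'⟩ := exists_lt_of_lt_csSup (hne v hv) (b := f v - ε) (by rw [← hf]; linarith)
    have hm : s * φ + t * ψ ∈ Set.Ico 0 c := (convex_Ico 0 c) hφ.1 hψ.1 hs ht hst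
    have h1 : s * φ + t * ψ ≤ f (s * u + t * v) := by
      rw [hf]
      refine le_csSup (hbdd _) ⟨hm, ?_⟩
      refine (hconv φ ψ s t hφ.1.1 hψ.1.1 hφ.1.2 hψ.1.2 hs ht hst hm.2).trans ?_
      exact add_le_add (mul_le_mul_of_nonneg_left hφ.2 hs) (mul_le_mul_of_nonneg_left hψ.2 ht)
    have h2 := mul_le_mul_of_nonneg_left hφ'.le hs
    have h3 := mul_le_mul_of_nonneg_left hψ'.le ht
    have h4 : s * ε + t * ε = ε := by rw [← add_mul, hst, one_mul]
    linarith
  · intro φ hφ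
    rw [hf]
    apply IsGreatest.csSup_eq
    refine ⟨⟨hφ, le_refl _⟩, ?_⟩
    intro ψ hψ
    by_contra! h
    have := hmono φ ψ hφ.1 h.le hψ.1.2
    have h2 := hψ.2
    have h3 : 0 < c * (ψ - φ) := mul_pos hc0 (by linarith)
    linarith
  · intro ρs hρs u hu
    have : {φ : ℝ | φ ∈ Set.Ico 0 c ∧ ρ φ ≤ u} = Set.Ico 0 c := by
      ext φ
      refine ⟨fun h => h.1, fun h => ⟨h, le_trans ?_ hu⟩⟩
      apply ge_of_tendsto hρs
      filter_upwards [Ioo_mem_nhdsLT h.2] with ψ hψ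
      have h1 := hmono φ ψ h.1 hψ.1.le hψ.2
      have h3 : 0 ≤ c * (ψ - φ) := mul_nonneg hc0.le (by linarith [hψ.1])
      linarith
    rw [hf, this, csSup_Ico hc0]
end
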